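/- arXiv:1606.06386 — 3 statements merged into one kernel-verified Lean document; each statement's English description precedes it below -/
import Mathlib

section
/- Let f : ℝ → ℝ and let g be a modulus of uniform continuity for f on [0,1]. Then there exists a real number I such that for every natural number n ≥ 1 and every tagged partition π of [0,1] with mesh ‖π‖ < 1/g(2n), one has |S_π(f) − I| ≤ 1/n; in particular f is Riemann integrable on [0,1] with modulus of Riemann integration depending only on g. -/
/-- A tagged partition of `[0,1]`: points `0 = x 0 ≤ x 1 ≤ … ≤ x M = 1`
with tags `t i ∈ [x i, x (i+1)]` for `i < M`. -/
structure TaggedPartition where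
  M : ℕ
  x : ℕ → ℝ
  t : ℕ → ℝ
  hM : 0 < M
  hx0 : x 0 = 0
  hxM : x M = 1
  mono : ∀ i < M, x i ≤ x (i + 1)
  tag : ∀ i < M, x i ≤ t i ∧ t i ≤ x (i + 1)

/-- The mesh `‖π‖ = max_{i<M} (x (i+1) - x i)`. -/
noncomputable def mesh (π : TaggedPartition) : ℝ :=
  (Finset.range π.M).sup' (Finset.nonempty_range_iff.mpr π.hM.ne')
    (fun i => π.x (i + 1) - π.x i)

/-- The Riemann sum `S_π(f) = Σ_{i<M} f (t i) * (x (i+1) - x i)`. -/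
noncomputable def RSum (f : ℝ → ℝ) (π : TaggedPartition) : ℝ :=
  ∑ i ∈ Finset.range π.M, f (π.t i) * (π.x (i + 1) - π.x i)

/-- `g` is a modulus of uniform continuity for `f` on `[0,1]`. -/
def ModUC (g : ℕ → ℕ) (f : ℝ → ℝ) : Prop :=
  (∀ k, 1 ≤ g k) ∧
  ∀ k, 1 ≤ k → ∀ x ∈ Set.Icc (0 : ℝ) 1, ∀ y ∈ Set.Icc (0 : ℝ) 1,
    |x - y| < 1 / (g k : ℝ) → |f x - f y| ≤ 1 / (k : ℝ)

theorem TaggedPartition.x_le_x (π : TaggedPartition) {i j : ℕ} (hij : i ≤ j) (hj : j ≤ π.M) :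
    π.x i ≤ π.x j := by
  induction j, hij using Nat.le_induction with
  | base => exact le_rfl
  | succ k _ ih => exact (ih (by omega)).trans (π.mono k (by omega))

theorem TaggedPartition.x_mem_Icc (π : TaggedPartition) {i : ℕ} (hi : i ≤ π.M) :
    π.x i ∈ Set.Icc (0 : ℝ) 1 :=
  ⟨π.hx0 ▸ π.x_le_x i.zero_le hi, π.hxM ▸ π.x_le_x hi le_rfl⟩

theorem TaggedPartition.Icc_subset (π : TaggedPartition) {i : ℕ} (hi : i < π.M) :
    Set.Icc (π.x i) (π.x (i + 1)) ⊆ Set.Icc (0 : ℝ) 1 :=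
  Set.Icc_subset_Icc (π.x_mem_Icc hi.le).1 (π.x_mem_Icc hi).2

theorem TaggedPartition.sub_le_mesh (π : TaggedPartition) {i : ℕ} (hi : i < π.M) :
    π.x (i + 1) - π.x i ≤ mesh π :=
  Finset.le_sup' (fun i => π.x (i + 1) - π.x i) (Finset.mem_range.mpr hi)

theorem ModUC.continuousOn {g : ℕ → ℕ} {f : ℝ → ℝ} (hg : ModUC g f) :
    ContinuousOn f (Set.Icc 0 1) := by
  refine Metric.continuousOn_iff.mpr fun x hx ε hε => ?_
  obtain ⟨k, hk⟩ := exists_nat_one_div_lt hε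
  have hpos : (0 : ℝ) < g (k + 1) := by exact_mod_cast hg.1 (k + 1)
  refine ⟨1 / g (k + 1), by positivity, fun y hy hxy => ?_⟩
  refine (hg.2 (k + 1) (by omega) y hy x hx hxy).trans_lt ?_
  exact_mod_cast hk

/-- If `f` oscillates by at most `C` on every interval of the partition, then the Riemann sum
is within `C` of the integral. -/
theorem abs_RSum_sub_integral_le {f : ℝ → ℝ} (hf : ContinuousOn f (Set.Icc 0 1))
    (π : TaggedPartition) {C : ℝ}
    (hC : ∀ i < π.M, ∀ y ∈ Set.Icc (π.x i) (π.x (i + 1)), |f (π.t i) - f y| ≤ C) :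
    |RSum f π - ∫ y in (0 : ℝ)..1, f y| ≤ C := by
  have hint : ∀ i < π.M, IntervalIntegrable f MeasureTheory.volume (π.x i) (π.x (i + 1)) :=
    fun i hi => (hf.mono (π.Icc_subset hi)).intervalIntegrable_of_Icc (π.mono i hi)
  have hsum := intervalIntegral.sum_integral_adjacent_intervals hint
  rw [π.hx0, π.hxM] at hsum
  rw [← hsum, RSum, ← Finset.sum_sub_distrib]
  calc |∑ i ∈ Finset.range π.M,
        (f (π.t i) * (π.x (i + 1) - π.x i) - ∫ y in π.x i..π.x (i + 1), f y)|
      ≤ ∑ i ∈ Finset.range π.M,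
        |f (π.t i) * (π.x (i + 1) - π.x i) - ∫ y in π.x i..π.x (i + 1), f y| :=
        Finset.abs_sum_le_sum_abs _ _
    _ ≤ ∑ i ∈ Finset.range π.M, C * (π.x (i + 1) - π.x i) := by
        refine Finset.sum_le_sum fun i hi => ?_
        have hi := Finset.mem_range.mp hi
        have hconst : f (π.t i) * (π.x (i + 1) - π.x i) =
            ∫ _ in π.x i..π.x (i + 1), f (π.t i) := by
          rw [intervalIntegral.integral_const, smul_eq_mul, mul_comm]
        rw [hconst, ← intervalIntegral.integral_sub intervalIntegrable_const (hint i hi),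
          ← abs_of_nonneg (sub_nonneg.mpr (π.mono i hi))]
        refine intervalIntegral.norm_integral_le_of_norm_le_const (E := ℝ) fun y hy => ?_
        rw [Set.uIoc_of_le (π.mono i hi)] at hy
        exact hC i hi y (Set.Ioc_subset_Icc_self hy)
    _ = C := by
        rw [← Finset.mul_sum, Finset.sum_range_sub, π.hx0, π.hxM, sub_zero, mul_one]

theorem riemann_integrable_with_modulus (f : ℝ → ℝ) (g : ℕ → ℕ) (hg : ModUC g f) :
    ∃ I : ℝ, ∀ n : ℕ, 1 ≤ n → ∀ π : TaggedPartition,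
      mesh π < 1 / (g (2 * n) : ℝ) → |RSum f π - I| ≤ 1 / (n : ℝ) := by
  refine ⟨∫ y in (0 : ℝ)..1, f y, fun n hn π hπ => ?_⟩
  have hn' : (0 : ℝ) < n := by exact_mod_cast hn
  refine (abs_RSum_sub_integral_le hg.continuousOn π (C := 1 / (2 * n : ℕ))
    fun i hi y hy => ?_).trans ?_
  · have ht : π.t i ∈ Set.Icc (π.x i) (π.x (i + 1)) := π.tag i hi
    refine hg.2 (2 * n) (by omega) _ (π.Icc_subset hi ht) _ (π.Icc_subset hi hy) ?_
    exact (Real.dist_le_of_mem_Icc ht hy).trans_lt ((π.sub_le_mesh hi).trans_lt hπ)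
  · refine one_div_le_one_div_of_le hn' ?_
    push_cast
    linarith
end

section
/- (Herbrandisation CRI_her(s,t) with explicit terms s(g,k') = 2k' and t(g,k') = g(2k').) For every f : ℝ → ℝ, every g : ℕ → ℕ with g(k) ≥ 1 for all k, and every natural number k' ≥ 1: if for all k ≤ 2k' with k ≥ 1 and all x, y ∈ [0,1], |x − y| < 1/g(k) implies |f(x) − f(y)| ≤ 1/k, then any two tagged partitions π, π' of [0,1] with mesh ‖π‖ < 1/g(2k') and ‖π'‖ < 1/g(2k') satisfy |S_π(f) − S_{π'}(f)| ≤ 1/k'. -/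
/-- The length of `[a, b] ∩ [c, d]`. -/
noncomputable def overlap (a b c d : ℝ) : ℝ := max 0 (min b d - max a c)

theorem overlap_nonneg (a b c d : ℝ) : 0 ≤ overlap a b c d := le_max_left _ _

theorem overlap_comm (a b c d : ℝ) : overlap a b c d = overlap c d a b := by
  rw [overlap, overlap, min_comm, max_comm a c]

theorem overlap_eq_clamp_sub {a b c d : ℝ} (hab : a ≤ b) (hcd : c ≤ d) :
    overlap a b c d = max a (min b d) - max a (min b c) := by
  grind [overlap]

namespace TaggedPartition

variable (π : TaggedPartition)

theorem nonneg {i : ℕ} (hi : i ≤ π.M) : 0 ≤ π.x i := by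
  induction i with
  | zero => exact π.hx0.ge
  | succ i ih => exact (ih (by omega)).trans (π.mono i (by omega))

theorem le_one {i : ℕ} (hi : i ≤ π.M) : π.x i ≤ 1 := by
  induction hi using Nat.decreasingInduction with
  | self => exact π.hxM.le
  | of_succ i hi ih => exact (π.mono i hi).trans ih

theorem tag_mem {i : ℕ} (hi : i < π.M) : π.t i ∈ Set.Icc (0 : ℝ) 1 :=
  ⟨(π.nonneg hi.le).trans (π.tag i hi).1, (π.tag i hi).2.trans (π.le_one hi)⟩

theorem sub_le_mesh_s3 {i : ℕ} (hi : i < π.M) : π.x (i + 1) - π.x i ≤ mesh π :=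
  Finset.le_sup' (fun i => π.x (i + 1) - π.x i) (Finset.mem_range.2 hi)

theorem sum_sub : ∑ i ∈ Finset.range π.M, (π.x (i + 1) - π.x i) = 1 := by
  rw [Finset.sum_range_sub, π.hxM, π.hx0, sub_zero]

theorem sum_overlap {a b : ℝ} (ha : 0 ≤ a) (hab : a ≤ b) (hb : b ≤ 1) :
    ∑ j ∈ Finset.range π.M, overlap a b (π.x j) (π.x (j + 1)) = b - a := by
  rw [Finset.sum_congr rfl fun j hj =>
      overlap_eq_clamp_sub hab (π.mono j (Finset.mem_range.1 hj)),
    Finset.sum_range_sub (fun j => max a (min b (π.x j))), π.hxM, π.hx0,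
    min_eq_left hb, max_eq_right hab, min_eq_right (ha.trans hab), max_eq_left ha]

theorem RSum_eq_sum_overlap (f : ℝ → ℝ) (π' : TaggedPartition) :
    RSum f π = ∑ i ∈ Finset.range π.M, ∑ j ∈ Finset.range π'.M,
      f (π.t i) * overlap (π.x i) (π.x (i + 1)) (π'.x j) (π'.x (j + 1)) := by
  refine Finset.sum_congr rfl fun i hi => ?_
  have hi := Finset.mem_range.1 hi
  rw [← Finset.mul_sum, π'.sum_overlap (π.nonneg hi.le) (π.mono i hi) (π.le_one hi)]

/-- If `f` varies by at most `ε` at distances below `δ`, then Riemann sums of mesh below `δ`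
differ by at most `2 * ε`. -/
theorem abs_RSum_sub_RSum_le {f : ℝ → ℝ} {δ ε : ℝ}
    (hf : ∀ x ∈ Set.Icc (0 : ℝ) 1, ∀ y ∈ Set.Icc (0 : ℝ) 1, |x - y| < δ → |f x - f y| ≤ ε)
    (π' : TaggedPartition) (h : mesh π < δ) (h' : mesh π' < δ) :
    |RSum f π - RSum f π'| ≤ 2 * ε := by
  let w : ℕ → ℕ → ℝ := fun i j => overlap (π.x i) (π.x (i + 1)) (π'.x j) (π'.x (j + 1))
  have key : ∀ i ∈ Finset.range π.M, ∀ j ∈ Finset.range π'.M,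
      |f (π.t i) * w i j - f (π'.t j) * w i j| ≤ 2 * ε * w i j := by
    intro i hi j hj
    have hi := Finset.mem_range.1 hi
    have hj := Finset.mem_range.1 hj
    have hw : 0 ≤ w i j := overlap_nonneg _ _ _ _
    rw [← sub_mul, abs_mul, abs_of_nonneg hw]
    rcases hw.eq_or_lt with h0 | hpos
    · simp [← h0]
    refine mul_le_mul_of_nonneg_right ?_ hw
    have hlt : max (π.x i) (π'.x j) < min (π.x (i + 1)) (π'.x (j + 1)) := by
      by_contra! hle
      exact hpos.ne' (max_eq_left (sub_nonpos.2 hle))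
    obtain ⟨z, hz, hz'⟩ : ∃ z, z ∈ Set.Icc (π.x i) (π.x (i + 1)) ∧
        z ∈ Set.Icc (π'.x j) (π'.x (j + 1)) :=
      ⟨_, ⟨le_max_left _ _, hlt.le.trans (min_le_left _ _)⟩,
        le_max_right _ _, hlt.le.trans (min_le_right _ _)⟩
    have hz01 : z ∈ Set.Icc (0 : ℝ) 1 :=
      ⟨(π.nonneg hi.le).trans hz.1, hz.2.trans (π.le_one hi)⟩
    have hfz := hf _ (π.tag_mem hi) z hz01 <|
      (abs_sub_le_of_le_of_le (π.tag i hi).1 (π.tag i hi).2 hz.1 hz.2).trans_lt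
        ((π.sub_le_mesh_s3 hi).trans_lt h)
    have hfz' := hf z hz01 _ (π'.tag_mem hj) <|
      (abs_sub_le_of_le_of_le hz'.1 hz'.2 (π'.tag j hj).1 (π'.tag j hj).2).trans_lt
        ((π'.sub_le_mesh_s3 hj).trans_lt h')
    linarith [abs_sub_le (f (π.t i)) (f z) (f (π'.t j))]
  have hS' : RSum f π' = ∑ i ∈ Finset.range π.M, ∑ j ∈ Finset.range π'.M,
      f (π'.t j) * w i j := by
    rw [π'.RSum_eq_sum_overlap f π, Finset.sum_comm]
    simp only [w, overlap_comm]
  have hW : ∑ i ∈ Finset.range π.M, ∑ j ∈ Finset.range π'.M, w i j = 1 := by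
    rw [← π.sum_sub]
    refine Finset.sum_congr rfl fun i hi => ?_
    have hi := Finset.mem_range.1 hi
    exact π'.sum_overlap (π.nonneg hi.le) (π.mono i hi) (π.le_one hi)
  calc |RSum f π - RSum f π'|
      = |∑ i ∈ Finset.range π.M, ∑ j ∈ Finset.range π'.M,
          (f (π.t i) * w i j - f (π'.t j) * w i j)| := by
        simp only [hS', π.RSum_eq_sum_overlap f π', Finset.sum_sub_distrib, w]
    _ ≤ ∑ i ∈ Finset.range π.M, ∑ j ∈ Finset.range π'.M, 2 * ε * w i j :=
        (Finset.abs_sum_le_sum_abs _ _).trans <| Finset.sum_le_sum fun i hi =>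
          (Finset.abs_sum_le_sum_abs _ _).trans <| Finset.sum_le_sum fun j hj => key i hi j hj
    _ = 2 * ε := by simp only [← Finset.mul_sum, hW, mul_one]

end TaggedPartition

theorem CRI_her (f : ℝ → ℝ) (g : ℕ → ℕ) (hg1 : ∀ k, 1 ≤ g k)
    (k' : ℕ) (hk' : 1 ≤ k')
    (huc : ∀ k, 1 ≤ k → k ≤ 2 * k' → ∀ x ∈ Set.Icc (0 : ℝ) 1, ∀ y ∈ Set.Icc (0 : ℝ) 1,
      |x - y| < 1 / (g k : ℝ) → |f x - f y| ≤ 1 / (k : ℝ))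
    (π π' : TaggedPartition)
    (h1 : mesh π < 1 / (g (2 * k') : ℝ)) (h2 : mesh π' < 1 / (g (2 * k') : ℝ)) :
    |RSum f π - RSum f π'| ≤ 1 / (k' : ℝ) := by
  refine (π.abs_RSum_sub_RSum_le (huc (2 * k') (by omega) le_rfl) π' h1 h2).trans_eq ?_
  push_cast
  field_simp
end

section
/- (The Gandy–Hyland functional equals its canonical approximation.) Let Y : (ℕ → ℕ) → ℕ be pointwise continuous and let γ : List ℕ → ℕ satisfy the Gandy–Hyland equation for Y. Then for every finite sequence s of natural numbers there exists N₀ such that G(Y, s, N) = γ(s) for all N ≥ N₀. -/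
/-- `app s h` is the infinite sequence obtained by extending the finite sequence `s`
with the values of `h`, i.e. `s ⌢ h`.  In particular `app (s ++ [0]) h` is `s⌢⟨0⟩⌢h`
and `app s (fun _ => 0)` is `s⌢0^ω`. -/
def app (s : List ℕ) (h : ℕ → ℕ) : ℕ → ℕ := fun n =>
  if hn : n < s.length then s[n] else h (n - s.length)

/-- `Y` is pointwise continuous on Baire space. -/
def PtwiseCont (Y : (ℕ → ℕ) → ℕ) : Prop :=
  ∀ f : ℕ → ℕ, ∃ N : ℕ, ∀ g : ℕ → ℕ, (∀ i < N, f i = g i) → Y f = Y g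

/-- The canonical approximation `G(Y, s, M)` of the Gandy–Hyland functional:
`G(Y,s,M) = Y(s⌢0^ω)` if `|s| ≥ M`, and
`G(Y,s,M) = Y(s⌢⟨0⟩⌢(λ n. G(Y, s⌢⟨n+1⟩, M)))` otherwise. -/
def G (Y : (ℕ → ℕ) → ℕ) (s : List ℕ) (M : ℕ) : ℕ :=
  if h : M ≤ s.length then Y (app s fun _ => 0)
  else Y (app (s ++ [0]) fun n => G Y (s ++ [n + 1]) M)
termination_by M - s.length
decreasing_by
  simp only [List.length_append, List.length_cons, List.length_nil]
  omega

/-- `γ` satisfies the Gandy–Hyland equation for `Y`. -/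
def GHEq (Y : (ℕ → ℕ) → ℕ) (γ : List ℕ → ℕ) : Prop :=
  ∀ s : List ℕ, γ s = Y (app (s ++ [0]) fun n => γ (s ++ [n + 1]))

theorem app_append_of_lt {s t : List ℕ} {h : ℕ → ℕ} {i : ℕ} (hi : i < s.length) :
    app (s ++ t) h i = s.getD i 0 := by
  have : i < s.length + t.length := by omega
  simp [app, hi, this, List.getElem_append_left]

theorem app_of_lt {s : List ℕ} {h : ℕ → ℕ} {i : ℕ} (hi : i < s.length) :
    app s h i = s.getD i 0 := by
  simp [app, hi]

theorem app_congr_of_lt {s : List ℕ} {h h' : ℕ → ℕ} {K : ℕ} (H : ∀ n < K, h n = h' n) {i : ℕ}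
    (hi : i < K) : app s h i = app s h' i := by
  unfold app
  split_ifs
  · rfl
  · exact H _ (by omega)

/-- If the canonical approximation converges to `γ` at every `s⌢⟨n+1⟩`, it does so at `s`. -/
theorem G_eventually_eq_of_succ {Y : (ℕ → ℕ) → ℕ} (hY : PtwiseCont Y) {γ : List ℕ → ℕ}
    (hγ : GHEq Y γ) (s : List ℕ)
    (H : ∀ n, ∃ N₀ : ℕ, ∀ N : ℕ, N₀ ≤ N → G Y (s ++ [n + 1]) N = γ (s ++ [n + 1])) :
    ∃ N₀ : ℕ, ∀ N : ℕ, N₀ ≤ N → G Y s N = γ s := by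
  choose m hm using H
  obtain ⟨K, hK⟩ := hY (app (s ++ [0]) fun n => γ (s ++ [n + 1]))
  refine ⟨max (s.length + 1) ((Finset.range K).sup m), fun N hN => ?_⟩
  have hlen : ¬ N ≤ s.length := by omega
  rw [G, dif_neg hlen, hγ s]
  refine (hK _ fun i hi => app_congr_of_lt (K := K) (fun n hn => ?_) hi).symm
  have : m n ≤ (Finset.range K).sup m := Finset.le_sup (Finset.mem_range.2 hn)
  exact (hm n N (by omega)).symm

/-- If `Y` is constant on the sequences extending `s`, then the canonical approximation
at `s` equals `γ s`. -/
theorem G_eq_of_const {Y : (ℕ → ℕ) → ℕ} {γ : List ℕ → ℕ} (hγ : GHEq Y γ) {s : List ℕ} {c : ℕ}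
    (hc : ∀ f : ℕ → ℕ, (∀ i < s.length, s.getD i 0 = f i) → Y f = c) (N : ℕ) :
    G Y s N = γ s := by
  rw [hγ s, hc _ fun i hi => (app_append_of_lt hi).symm, G]
  split_ifs
  · exact hc _ fun i hi => (app_of_lt hi).symm
  · exact hc _ fun i hi => (app_append_of_lt hi).symm

/-- Bar induction for a predicate on finite sequences: `P` holds at `s` if it is inherited
from the extensions `t⌢⟨n+1⟩` to `t` and every infinite sequence has an index beyond which
all its initial segments satisfy `P`. -/
theorem bar_induction_succ {P : List ℕ → Prop} (step : ∀ t, (∀ n, P (t ++ [n + 1])) → P t)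
    (bar : ∀ α : ℕ → ℕ, ∃ K, ∀ t : List ℕ, K ≤ t.length →
      (∀ i < t.length, t.getD i 0 = α i) → P t) (s : List ℕ) : P s := by
  by_contra hs
  have ext : ∀ t, ∃ n, ¬ P t → ¬ P (t ++ [n + 1]) := fun t => by
    by_contra! h
    exact (h 0).1 (step t fun n => (h n).2)
  choose e he using ext
  obtain ⟨L, hL₀, hL⟩ : ∃ L : ℕ → List ℕ, L 0 = s ∧ ∀ k, L (k + 1) = L k ++ [e (L k) + 1] :=
    ⟨fun k => Nat.rec s (fun _ t => t ++ [e t + 1]) k, rfl, fun _ => rfl⟩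
  have hP : ∀ k, ¬ P (L k) := fun k => by
    induction k with
    | zero => rwa [hL₀]
    | succ k ih => exact hL k ▸ he _ ih
  have hlen : ∀ k, (L k).length = s.length + k := fun k => by
    induction k with
    | zero => rw [hL₀, Nat.add_zero]
    | succ k ih => rw [hL, List.length_append, ih]; rfl
  have hpre : ∀ k j, L k <+: L (k + j) := fun k j => by
    induction j with
    | zero => exact List.prefix_rfl
    | succ j ih => exact ih.trans (hL (k + j) ▸ List.prefix_append _ _)
  have hget : ∀ k j i, i < (L k).length → (L k).getD i 0 = (L (k + j)).getD i 0 := by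
    intro k j i hi
    obtain ⟨u, hu⟩ := hpre k j
    rw [← hu, List.getD_append _ _ _ _ hi]
  obtain ⟨K, hK⟩ := bar fun i => (L (i + 1)).getD i 0
  refine hP K (hK _ (by rw [hlen]; omega) fun i hi => ?_)
  have hi' : i < (L (i + 1)).length := by rw [hlen]; omega
  rw [hget K (i + 1) i hi, hget (i + 1) K i hi', Nat.add_comm K]

theorem gandy_hyland_eq_canonical_approx (Y : (ℕ → ℕ) → ℕ) (hY : PtwiseCont Y)
    (γ : List ℕ → ℕ) (hγ : GHEq Y γ) (s : List ℕ) :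
    ∃ N₀ : ℕ, ∀ N : ℕ, N₀ ≤ N → G Y s N = γ s := by
  refine bar_induction_succ (P := fun s => ∃ N₀ : ℕ, ∀ N : ℕ, N₀ ≤ N → G Y s N = γ s)
    (G_eventually_eq_of_succ hY hγ) (fun α => ?_) s
  obtain ⟨K, hK⟩ := hY α
  refine ⟨K, fun t ht hα => ⟨0, fun N _ => G_eq_of_const hγ (c := Y α) (fun f hf => ?_) N⟩⟩
  exact (hK f fun i hi => (hα i (by omega)).symm.trans (hf i (by omega))).symm
end
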